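/- Let T₁, T₂, T₃ be three pairwise different tiles, i.e. Tᵢ = γᵢ(F) with γ₁, γ₂, γ₃ ∈ Γ giving pairwise distinct sets. Then there exist two distinct elements M₁ and M₂ of 𝓜 such that T₁ ∩ T₂ ∩ T₃ ⊆ M₁ ∩ M₂. -/

import Mathlib

noncomputable section

open scoped Classical
open MeasureTheory

namespace Hilbert

/-- `k₀ = 2` if `k ≡ 1 (mod 4)` and `k₀ = 1` otherwise. -/
def k0 (k : ℕ) : ℝ := if k % 4 = 1 then 2 else 1

/-- `ω = (1 + √k)/k₀`. -/
def omg (k : ℕ) : ℝ := (1 + Real.sqrt k) / k0 k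

/-- `ω' = (1 - √k)/k₀`, the algebraic conjugate of `ω`. -/
def omg' (k : ℕ) : ℝ := (1 - Real.sqrt k) / k0 k

/-- The ring `R = ℤ[ω]`, realized inside `ℝ × ℝ` via the pair of real embeddings
`α ↦ (α, α')` of `K = ℚ(√k)`. -/
def R (k : ℕ) : Subring (ℝ × ℝ) := Subring.closure {(omg k, omg' k)}

/-- The ambient space `ℝ⁴`, with coordinates `(x₁, x₂, y₁, y₂)`. -/
abbrev Pt : Type := ℝ × ℝ × ℝ × ℝ

def x1 (p : Pt) : ℝ := p.1
def x2 (p : Pt) : ℝ := p.2.1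
def y1 (p : Pt) : ℝ := p.2.2.1
def y2 (p : Pt) : ℝ := p.2.2.2

/-- `H² × H²`, identified with an open subset of `ℝ⁴`. -/
def HH : Set Pt := {p | 0 < y1 p ∧ 0 < y2 p}

/-- The coordinate `s₁`, determined by `x₁ = s₁ + s₂ ω`, `x₂ = s₁ + s₂ ω'`. -/
def s1 (k : ℕ) (p : Pt) : ℝ := (omg' k * x1 p - omg k * x2 p) / (omg' k - omg k)

/-- The coordinate `s₂`. -/
def s2 (k : ℕ) (p : Pt) : ℝ := (x1 p - x2 p) / (omg k - omg' k)

/-- The ratio `r = y₁/y₂`. -/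
def rr (p : Pt) : ℝ := y1 p / y2 p

/-- The height `h = y₁ y₂`. -/
def hh (p : Pt) : ℝ := y1 p * y2 p

/-- `‖cZ+d‖ = ((cx₁+d)² + c²y₁²)((c'x₂+d')² + c'²y₂²)`, where `c = (c, c')`, `d = (d, d')`
are given by their two real embeddings. -/
def HNorm (c d : ℝ × ℝ) (p : Pt) : ℝ :=
  ((c.1 * x1 p + d.1) ^ 2 + c.1 ^ 2 * y1 p ^ 2) *
    ((c.2 * x2 p + d.2) ^ 2 + c.2 ^ 2 * y2 p ^ 2)

/-- `S = {(c,d) ∈ R² : cR + dR = R}`. -/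
def Spairs (k : ℕ) : Set (R k × R k) := {cd | Ideal.span {cd.1, cd.2} = ⊤}

/-- `V_{c,d}^≥ = {Z ∈ H²×H² : ‖cZ+d‖ ≥ 1}`. -/
def Vge (k : ℕ) (cd : R k × R k) : Set Pt :=
  {p ∈ HH | 1 ≤ HNorm (cd.1 : ℝ × ℝ) (cd.2 : ℝ × ℝ) p}

/-- `V_{c,d}^≤ = {Z ∈ H²×H² : ‖cZ+d‖ ≤ 1}`. -/
def Vle (k : ℕ) (cd : R k × R k) : Set Pt :=
  {p ∈ HH | HNorm (cd.1 : ℝ × ℝ) (cd.2 : ℝ × ℝ) p ≤ 1}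

/-- `V_{c,d} = {Z ∈ H²×H² : ‖cZ+d‖ = 1}`. -/
def Veq (k : ℕ) (cd : R k × R k) : Set Pt :=
  {p ∈ HH | HNorm (cd.1 : ℝ × ℝ) (cd.2 : ℝ × ℝ) p = 1}

/-- `F₀ = {Z ∈ H²×H² : ‖cZ+d‖ ≥ 1 for all (c,d) ∈ S}`. -/
def F0 (k : ℕ) : Set Pt :=
  {p ∈ HH | ∀ cd ∈ Spairs k, 1 ≤ HNorm (cd.1 : ℝ × ℝ) (cd.2 : ℝ × ℝ) p}

/-- `F_∞ = {(s₁,s₂,r,h) : |s₁| ≤ 1/2, |s₂| ≤ 1/2, ε₀⁻² ≤ r ≤ ε₀²}`, where `ε` stands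
for the fundamental unit `ε₀`. -/
def FInf (k : ℕ) (ε : ℝ) : Set Pt :=
  {p ∈ HH | |s1 k p| ≤ 1 / 2 ∧ |s2 k p| ≤ 1 / 2 ∧ (ε ^ 2)⁻¹ ≤ rr p ∧ rr p ≤ ε ^ 2}

/-- `F = F_∞ ∩ F₀`. -/
def F (k : ℕ) (ε : ℝ) : Set Pt := FInf k ε ∩ F0 k

/-- `SL₂(R)`. -/
abbrev SL (k : ℕ) := Matrix.SpecialLinearGroup (Fin 2) (R k)

/-- Möbius action on the upper half-plane: image of `x + y i` under `(a b; c d)`. -/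
def moeb (a b c d x y : ℝ) : ℝ × ℝ :=
  (((a * x + b) * (c * x + d) + a * c * y ^ 2) / ((c * x + d) ^ 2 + c ^ 2 * y ^ 2),
    y / ((c * x + d) ^ 2 + c ^ 2 * y ^ 2))

/-- The action of `γ ∈ SL₂(R)` on `H²×H²`: `γ` acts on the first factor through the first
embedding and through the conjugate matrix `γ'` (second embedding) on the second factor.
This descends to the Hilbert modular group `PSL₂(R)`. -/
def act (k : ℕ) (g : SL k) (p : Pt) : Pt :=
  ((moeb (g.1 0 0 : ℝ × ℝ).1 (g.1 0 1 : ℝ × ℝ).1 (g.1 1 0 : ℝ × ℝ).1 (g.1 1 1 : ℝ × ℝ).1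
      (x1 p) (y1 p)).1,
   (moeb (g.1 0 0 : ℝ × ℝ).2 (g.1 0 1 : ℝ × ℝ).2 (g.1 1 0 : ℝ × ℝ).2 (g.1 1 1 : ℝ × ℝ).2
      (x2 p) (y2 p)).1,
   (moeb (g.1 0 0 : ℝ × ℝ).1 (g.1 0 1 : ℝ × ℝ).1 (g.1 1 0 : ℝ × ℝ).1 (g.1 1 1 : ℝ × ℝ).1
      (x1 p) (y1 p)).2,
   (moeb (g.1 0 0 : ℝ × ℝ).2 (g.1 0 1 : ℝ × ℝ).2 (g.1 1 0 : ℝ × ℝ).2 (g.1 1 1 : ℝ × ℝ).2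
      (x2 p) (y2 p)).2)

/-- The pair of real embeddings of a unit of `R`. -/
def unitVal (k : ℕ) (u : (R k)ˣ) : ℝ × ℝ := ((u : R k) : ℝ × ℝ)

/-- `e` is the fundamental unit of `R`: the smallest unit of `R` greater than `1`
(with respect to the first embedding). -/
def IsFundUnit (k : ℕ) (e : (R k)ˣ) : Prop :=
  1 < (unitVal k e).1 ∧
    ∀ v : (R k)ˣ, 1 < (unitVal k v).1 → (unitVal k e).1 ≤ (unitVal k v).1

/-- The real number `ε₀ > 1`, the fundamental unit under the first embedding. -/
def eps (k : ℕ) (e : (R k)ˣ) : ℝ := (unitVal k e).1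


/-- The norm `N(c) = c c'` of an element of `R` (as a real number). -/
def Nm (k : ℕ) (c : R k) : ℝ := ((c : ℝ × ℝ)).1 * ((c : ℝ × ℝ)).2

/-- A subset `C` of `H²×H²` is hyperbolically bounded if it is bounded in the
Euclidean metric and `y₁, y₂ > ε` on `C` for some `ε > 0`. -/
def HypBounded (C : Set Pt) : Prop :=
  C ⊆ HH ∧ Bornology.IsBounded C ∧ ∃ ε > (0 : ℝ), ∀ p ∈ C, ε < y1 p ∧ ε < y2 p

/-- `V_{C,μ} = {(c,d) ∈ R × R : ‖cZ+d‖ ≤ μ for some Z ∈ C}`. -/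
def VCmu (k : ℕ) (C : Set Pt) (μ : ℝ) : Set (R k × R k) :=
  {cd | ∃ p ∈ C, HNorm (cd.1 : ℝ × ℝ) (cd.2 : ℝ × ℝ) p ≤ μ}

/-- The conditions (8) of Theorem `FiniteSides` on a pair `(c,d) ∈ R²`. -/
def SCond (k : ℕ) (ε : ℝ) (cd : R k × R k) : Prop :=
  cd.1 ≠ 0 ∧ Ideal.span {cd.1, cd.2} = ⊤ ∧
    |Nm k cd.1| ≤ 2 * k / (k0 k) ^ 2 ∧
    |((cd.2 : ℝ × ℝ)).1 / ((cd.1 : ℝ × ℝ)).1| <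
      ε * Real.sqrt (2 * k / (Nm k cd.1 ^ 2 * (k0 k) ^ 2) - (k0 k) ^ 2 / (2 * k)) +
        (1 + omg k) / 2 ∧
    |((cd.2 : ℝ × ℝ)).2 / ((cd.1 : ℝ × ℝ)).2| <
      ε * Real.sqrt (2 * k / (Nm k cd.1 ^ 2 * (k0 k) ^ 2) - (k0 k) ^ 2 / (2 * k)) +
        (1 - omg' k) / 2

/-- `S₁` is a set of representatives, up to multiplication by units of `R`, of the pairs
`(c,d) ∈ R²` satisfying the conditions `SCond`. -/
def IsRepSet (k : ℕ) (ε : ℝ) (S1 : Set (R k × R k)) : Prop :=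
  (∀ cd ∈ S1, SCond k ε cd) ∧
    (∀ cd : R k × R k, SCond k ε cd →
      ∃ ab ∈ S1, ∃ u : (R k)ˣ, cd.1 = (u : R k) * ab.1 ∧ cd.2 = (u : R k) * ab.2) ∧
    (∀ ab ∈ S1, ∀ ab' ∈ S1,
      (∃ u : (R k)ˣ, ab'.1 = (u : R k) * ab.1 ∧ ab'.2 = (u : R k) * ab.2) → ab = ab')

/-- The family `𝒱_∞ = {V_i^± : i = 1,2,3}`. -/
def VfamInf (k : ℕ) (ε : ℝ) : Set (Set Pt) :=
  { {p ∈ HH | s1 k p = 1 / 2}, {p ∈ HH | s1 k p = -(1 / 2)},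
    {p ∈ HH | s2 k p = 1 / 2}, {p ∈ HH | s2 k p = -(1 / 2)},
    {p ∈ HH | rr p = ε ^ 2}, {p ∈ HH | rr p = (ε ^ 2)⁻¹} }

/-- The family `𝒱 = {V_{c,d} : (c,d) ∈ S, c ≠ 0}`. -/
def Vfam (k : ℕ) : Set (Set Pt) :=
  {V | ∃ cd ∈ Spairs k, cd.1 ≠ 0 ∧ V = Veq k cd}

/-- The family `𝓜 = {γ(M) : γ ∈ Γ, M ∈ 𝒱 ∪ 𝒱_∞}`. -/
def Mfam (k : ℕ) (ε : ℝ) : Set (Set Pt) :=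
  {M | ∃ g : SL k, ∃ V ∈ Vfam k ∪ VfamInf k ε, M = act k g '' V}

/-- `ω` as an element of `R`. -/
def omR (k : ℕ) : R k := ⟨(omg k, omg' k), Subring.subset_closure rfl⟩

/-- The side-pairing transformations: `γ ≠ 1` (in `PSL₂(R)`) such that `F ∩ γ⁻¹(F)` has
Hausdorff dimension `3`. -/
def SidePairings (k : ℕ) (ε : ℝ) : Set (SL k) :=
  {g | g ≠ 1 ∧ g.1 ≠ -1 ∧ dimH (F k ε ∩ act k g⁻¹ '' F k ε) = 3}


/-! ### Arithmetic of `R` -/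

lemma k0_pos (k : ℕ) : 0 < k0 k := by unfold k0; split_ifs <;> norm_num

lemma omg_sub (k : ℕ) (hk1 : 1 < k) : 0 < omg k - omg' k := by
  have h := k0_pos k
  have hs : 0 < Real.sqrt k := Real.sqrt_pos.mpr (by positivity)
  have : omg k - omg' k = 2 * Real.sqrt k / k0 k := by unfold omg omg'; ring
  rw [this]; positivity

lemma omg_TN (k : ℕ) : ∃ T N : ℤ, omg k + omg' k = T ∧ omg k * omg' k = N := by
  have hs : Real.sqrt k ^ 2 = k := Real.sq_sqrt (by positivity)
  by_cases h : k % 4 = 1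
  · refine ⟨1, -(k / 4 : ℕ), ?_, ?_⟩
    · simp only [omg, omg', k0, if_pos h]; push_cast; ring
    · have hk : (k : ℝ) = 4 * (k / 4 : ℕ) + 1 := by
        have : k = 4 * (k / 4) + 1 := by omega
        exact_mod_cast this
      simp only [omg, omg', k0, if_pos h, Int.cast_neg, Int.cast_natCast]
      linear_combination (-1/4) * hs - (1/4) * hk
  · refine ⟨2, 1 - k, ?_, ?_⟩
    · simp only [omg, omg', k0, if_neg h]; push_cast; ring
    · simp only [omg, omg', k0, if_neg h]; push_cast; linear_combination - hs

lemma R_rep (k : ℕ) (r : R k) : ∃ m n : ℤ, (r : ℝ × ℝ).1 = m + n * omg k ∧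
    (r : ℝ × ℝ).2 = m + n * omg' k := by
  obtain ⟨r, hr⟩ := r
  obtain ⟨T, N, hT, hN⟩ := omg_TN k
  simp only
  unfold R at hr
  induction hr using Subring.closure_induction with
  | mem x hx => 
    rw [Set.mem_singleton_iff] at hx; subst hx
    exact ⟨0, 1, by simp, by simp⟩
  | zero => exact ⟨0, 0, by simp, by simp⟩
  | one => exact ⟨1, 0, by simp, by simp⟩
  | add x y _ _ hx hy =>
    obtain ⟨m, n, h1, h2⟩ := hx
    obtain ⟨m', n', h1', h2'⟩ := hy
    refine ⟨m + m', n + n', ?_, ?_⟩ <;> simp [h1, h2, h1', h2'] <;> ring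
  | neg x _ hx =>
    obtain ⟨m, n, h1, h2⟩ := hx
    refine ⟨-m, -n, ?_, ?_⟩ <;> simp [h1, h2] <;> ring
  | mul x y _ _ hx hy =>
    obtain ⟨m, n, h1, h2⟩ := hx
    obtain ⟨m', n', h1', h2'⟩ := hy
    refine ⟨m * m' - n * n' * N, m * n' + n * m' + n * n' * T, ?_, ?_⟩ <;>
      simp only [Prod.fst_mul, Prod.snd_mul, h1, h2, h1', h2'] <;> push_cast <;> rw [← hT, ← hN] <;> ring

lemma Nm_int (k : ℕ) (r : R k) : ∃ n : ℤ, (r : ℝ × ℝ).1 * (r : ℝ × ℝ).2 = n := by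
  obtain ⟨T, N, hT, hN⟩ := omg_TN k
  obtain ⟨m, n, h1, h2⟩ := R_rep k r
  refine ⟨m ^ 2 + m * n * T + n ^ 2 * N, ?_⟩
  rw [h1, h2]; push_cast; rw [← hT, ← hN]; ring

lemma irr (k : ℕ) (hk : Squarefree k) (hk1 : 1 < k) : Irrational (Real.sqrt k) := by
  rw [irrational_sqrt_natCast_iff]
  rintro ⟨j, rfl⟩
  have := hk j dvd_rfl
  rw [Nat.isUnit_iff] at this
  subst this; simp at hk1

lemma int_comb (k : ℕ) (hk : Squarefree k) (hk1 : 1 < k) (m n : ℤ)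
    (h : (m : ℝ) + n * omg k = 0 ∨ (m : ℝ) + n * omg' k = 0) : m = 0 ∧ n = 0 := by
  have hi := irr k hk hk1
  have hn : n = 0 := by
    by_contra hn
    have hn' : (n : ℝ) ≠ 0 := by exact_mod_cast hn
    have hex : ∃ q : ℤ, k0 k = q := by
      unfold k0; split_ifs
      · exact ⟨2, by norm_num⟩
      · exact ⟨1, by norm_num⟩
    obtain ⟨q, hq⟩ := hex
    have h0 := (k0_pos k).ne'
    rcases h with h | h
    · apply hi
      refine ⟨-(m * q) / n - 1, ?_⟩
      push_cast
      rw [← hq]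
      unfold omg at h
      field_simp at h ⊢
      linarith
    · apply hi
      refine ⟨(m * q) / n + 1, ?_⟩
      push_cast
      rw [← hq]
      unfold omg' at h
      field_simp at h ⊢
      linarith
  subst hn
  refine ⟨?_, rfl⟩
  simpa using h

lemma R_inj (k : ℕ) (hk : Squarefree k) (hk1 : 1 < k) (r : R k)
    (h : (r : ℝ × ℝ).1 = 0 ∨ (r : ℝ × ℝ).2 = 0) : r = 0 := by
  obtain ⟨m, n, h1, h2⟩ := R_rep k r
  rw [h1, h2] at h
  obtain ⟨rfl, rfl⟩ := int_comb k hk hk1 m n h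
  apply Subtype.ext
  apply Prod.ext
  · simpa using h1
  · simpa using h2

lemma unit_norm (k : ℕ) (a d : R k) (h : a * d = 1) :
    |(a : ℝ × ℝ).1| * |(a : ℝ × ℝ).2| = 1 := by
  obtain ⟨m, hm⟩ := Nm_int k a
  obtain ⟨n, hn⟩ := Nm_int k d
  have h' : ((a : ℝ × ℝ) * (d : ℝ × ℝ)) = 1 := by
    rw [← Subring.coe_mul, h]; rfl
  have e1 : (a : ℝ × ℝ).1 * (d : ℝ × ℝ).1 = 1 := congrArg Prod.fst h'
  have e2 : (a : ℝ × ℝ).2 * (d : ℝ × ℝ).2 = 1 := congrArg Prod.snd h'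
  have : m * n = 1 := by
    have : (m : ℝ) * n = 1 := by
      rw [← hm, ← hn]; linear_combination (a : ℝ × ℝ).2 * (d : ℝ × ℝ).2 * e1 + e2
    exact_mod_cast this
  rw [← abs_mul, hm]
  have := Int.isUnit_iff_abs_eq.mp (IsUnit.of_mul_eq_one n this)
  exact_mod_cast this

lemma fund_le (k : ℕ) (e : (R k)ˣ) (he : IsFundUnit k e) (a d : R k) (h : a * d = 1)
    (h1 : 1 < |(a : ℝ × ℝ).1|) : eps k e ≤ |(a : ℝ × ℝ).1| := by
  let u : (R k)ˣ := ⟨a, d, h, by rw [mul_comm]; exact h⟩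
  rcases abs_cases (a : ℝ × ℝ).1 with ⟨h2, _⟩ | ⟨h2, _⟩
  · rw [h2] at h1 ⊢
    exact he.2 u h1
  · rw [h2] at h1 ⊢
    have := he.2 (-u) (by simpa [unitVal, u] using h1)
    simpa [unitVal, u, eps] using this

/-! ### The action -/

lemma moeb_den (a b c d x y : ℝ) (h : a * d - b * c = 1) (hy : 0 < y) :
    0 < (c * x + d) ^ 2 + c ^ 2 * y ^ 2 := by
  by_cases hc : c = 0
  · subst hc
    have : d ≠ 0 := by rintro rfl; simp at h
    simp; positivity
  · positivity

lemma moeb_comp (a b c d a' b' c' d' x y : ℝ) (h : a * d - b * c = 1)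
    (h' : a' * d' - b' * c' = 1) (hy : 0 < y) :
    moeb a' b' c' d' (moeb a b c d x y).1 (moeb a b c d x y).2 =
      moeb (a' * a + b' * c) (a' * b + b' * d) (c' * a + d' * c) (c' * b + d' * d) x y := by
  have hD := moeb_den a b c d x y h hy
  have hE := moeb_den (a' * a + b' * c) (a' * b + b' * d) (c' * a + d' * c) (c' * b + d' * d) x y
    (by linear_combination (a' * d' - b' * c') * h + h') hy
  unfold moeb
  simp only
  set D := (c * x + d) ^ 2 + c ^ 2 * y ^ 2 with hDd
  set E := ((c' * a + d' * c) * x + (c' * b + d' * d)) ^ 2 + (c' * a + d' * c) ^ 2 * y ^ 2 with hEd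
  set P := (a * x + b) * (c * x + d) + a * c * y ^ 2 with hP
  have hPy : P ^ 2 + y ^ 2 = ((a * x + b) ^ 2 + a ^ 2 * y ^ 2) * D := by
    rw [hP, hDd]; linear_combination (-y ^ 2 * (a * d - b * c) - y ^ 2) * h
  have key : (c' * (P / D) + d') ^ 2 + c' ^ 2 * (y / D) ^ 2 = E / D := by
    field_simp
    have : E = c' ^ 2 * ((a * x + b) ^ 2 + a ^ 2 * y ^ 2) + 2 * c' * d' * P + d' ^ 2 * D := by
      rw [hEd, hP, hDd]; ring
    rw [this]; linear_combination c' ^ 2 * hPy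
  rw [key]
  refine Prod.ext ?_ ?_
  · simp only
    have k2 : (a' * (P / D) + b') * (c' * (P / D) + d') + a' * c' * (y / D) ^ 2 =
      (((a' * a + b' * c) * x + (a' * b + b' * d)) * ((c' * a + d' * c) * x + (c' * b + d' * d)) +
        (a' * a + b' * c) * (c' * a + d' * c) * y ^ 2) / D := by
      field_simp
      have : (((a' * a + b' * c) * x + (a' * b + b' * d)) * ((c' * a + d' * c) * x + (c' * b + d' * d)) +
        (a' * a + b' * c) * (c' * a + d' * c) * y ^ 2) =
          a' * c' * ((a * x + b) ^ 2 + a ^ 2 * y ^ 2) + (a' * d' + b' * c') * P + b' * d' * D := by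
        rw [hP, hDd]; ring
      linear_combination a' * c' * hPy - D * this
    rw [k2]; field_simp
  · simp only
    field_simp

lemma det1 (k : ℕ) (g : SL k) : g.1 0 0 * g.1 1 1 - g.1 0 1 * g.1 1 0 = 1 := by
  rw [← Matrix.det_fin_two]; exact g.2

lemma det_fst (k : ℕ) (g : SL k) : (g.1 0 0 : ℝ × ℝ).1 * (g.1 1 1 : ℝ × ℝ).1
    - (g.1 0 1 : ℝ × ℝ).1 * (g.1 1 0 : ℝ × ℝ).1 = 1 := by
  have := congrArg (fun r : R k => (r : ℝ × ℝ).1) (det1 k g)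
  simpa using this

lemma det_snd (k : ℕ) (g : SL k) : (g.1 0 0 : ℝ × ℝ).2 * (g.1 1 1 : ℝ × ℝ).2
    - (g.1 0 1 : ℝ × ℝ).2 * (g.1 1 0 : ℝ × ℝ).2 = 1 := by
  have := congrArg (fun r : R k => (r : ℝ × ℝ).2) (det1 k g)
  simpa using this

lemma act_mul (k : ℕ) (g h : SL k) (p : Pt) (hp : p ∈ HH) :
    act k (g * h) p = act k g (act k h p) := by
  have e1 := moeb_comp _ _ _ _ _ _ _ _ (x1 p) (y1 p) (det_fst k h) (det_fst k g) hp.1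
  have e2 := moeb_comp _ _ _ _ _ _ _ _ (x2 p) (y2 p) (det_snd k h) (det_snd k g) hp.2
  have m : ∀ i j, (g * h).1 i j = g.1 i 0 * h.1 0 j + g.1 i 1 * h.1 1 j := by
    intro i j
    simp [Matrix.mul_apply, Fin.sum_univ_two]
  unfold act
  simp only [m, Subring.coe_add, Subring.coe_mul, Prod.fst_add, Prod.snd_add, Prod.fst_mul,
    Prod.snd_mul, ← e1, ← e2]
  rfl

lemma act_one (k : ℕ) (p : Pt) : act k 1 p = p := by
  simp [act, moeb, x1, x2, y1, y2]

lemma act_HH (k : ℕ) (g : SL k) (p : Pt) (hp : p ∈ HH) : act k g p ∈ HH :=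
  ⟨div_pos hp.1 (moeb_den _ _ _ _ _ _ (det_fst k g) hp.1),
    div_pos hp.2 (moeb_den _ _ _ _ _ _ (det_snd k g) hp.2)⟩

lemma act_inv_act (k : ℕ) (g : SL k) (p : Pt) (hp : p ∈ HH) : act k g⁻¹ (act k g p) = p := by
  rw [← act_mul k _ _ p hp, inv_mul_cancel, act_one]

lemma inv_ent (k : ℕ) (g : SL k) : (g⁻¹).1 0 0 = g.1 1 1 ∧ (g⁻¹).1 0 1 = - g.1 0 1 ∧
    (g⁻¹).1 1 0 = - g.1 1 0 ∧ (g⁻¹).1 1 1 = g.1 0 0 := by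
  simp [Matrix.SpecialLinearGroup.SL2_inv_expl]

lemma mul_ent (k : ℕ) (g h : SL k) (i j : Fin 2) :
    (g * h).1 i j = g.1 i 0 * h.1 0 j + g.1 i 1 * h.1 1 j := by
  simp [Matrix.mul_apply, Fin.sum_univ_two]

lemma F_HH {k : ℕ} {ε : ℝ} {p : Pt} (h : p ∈ F k ε) : p ∈ HH := h.1.1

lemma fam_HH {k : ℕ} {ε : ℝ} {V : Set Pt} (h : V ∈ Vfam k ∪ VfamInf k ε) : V ⊆ HH := by
  rcases h with ⟨cd, _, _, rfl⟩ | h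
  · exact fun p hp => hp.1
  · simp only [VfamInf, Set.mem_insert_iff, Set.mem_singleton_iff] at h
    rcases h with rfl | rfl | rfl | rfl | rfl | rfl <;> exact fun p hp => hp.1

/-- The conclusion. -/
def Concl (k : ℕ) (ε : ℝ) (g1 g2 g3 : SL k) : Prop :=
  ∃ M1 ∈ Mfam k ε, ∃ M2 ∈ Mfam k ε, M1 ≠ M2 ∧
      act k g1 '' F k ε ∩ act k g2 '' F k ε ∩ act k g3 '' F k ε ⊆ M1 ∩ M2

lemma Concl.swap {k : ℕ} {ε : ℝ} {g1 g2 g3 : SL k} (h : Concl k ε g1 g3 g2) :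
    Concl k ε g1 g2 g3 := by
  obtain ⟨M1, h1, M2, h2, h3, h4⟩ := h
  exact ⟨M1, h1, M2, h2, h3, fun p hp => h4 ⟨⟨hp.1.1, hp.2⟩, hp.1.2⟩⟩

lemma Concl.rot {k : ℕ} {ε : ℝ} {g1 g2 g3 : SL k} (h : Concl k ε g2 g3 g1) :
    Concl k ε g1 g2 g3 := by
  obtain ⟨M1, h1, M2, h2, h3, h4⟩ := h
  exact ⟨M1, h1, M2, h2, h3, fun p hp => h4 ⟨⟨hp.1.2, hp.2⟩, hp.1.1⟩⟩

/-- `p ∈ F ∩ γ F`. -/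
def Tl (k : ℕ) (ε : ℝ) (g : SL k) (p : Pt) : Prop := p ∈ F k ε ∧ ∃ q ∈ F k ε, p = act k g q

lemma core (k : ℕ) (ε : ℝ) (g1 g2 g3 : SL k) (V W : Set Pt)
    (hV : V ∈ Vfam k ∪ VfamInf k ε) (hW : W ∈ Vfam k ∪ VfamInf k ε) (hne : V ≠ W)
    (h : ∀ p, Tl k ε (g1⁻¹ * g2) p → Tl k ε (g1⁻¹ * g3) p → p ∈ V ∧ p ∈ W) :
    Concl k ε g1 g2 g3 := by
  refine ⟨_, ⟨g1, V, hV, rfl⟩, _, ⟨g1, W, hW, rfl⟩, ?_, ?_⟩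
  · intro he
    apply hne
    have : ∀ A B : Set Pt, A ⊆ HH → B ⊆ HH → act k g1 '' A = act k g1 '' B → A ⊆ B := by
      intro A B hA hB hAB p hp
      obtain ⟨q, hq, hqp⟩ : act k g1 p ∈ act k g1 '' B := hAB ▸ ⟨p, hp, rfl⟩
      have := congrArg (act k g1⁻¹) hqp
      rw [act_inv_act k _ _ (hB hq), act_inv_act k _ _ (hA hp)] at this
      exact this ▸ hq
    exact subset_antisymm (this _ _ (fam_HH hV) (fam_HH hW) he)
      (this _ _ (fam_HH hW) (fam_HH hV) he.symm)
  · rintro _ ⟨⟨⟨p, hp, rfl⟩, ⟨q, hq, hqp⟩⟩, ⟨r, hr, hrp⟩⟩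
    have := h p ⟨hp, q, hq, ?_⟩ ⟨hp, r, hr, ?_⟩
    · exact ⟨⟨p, this.1, rfl⟩, ⟨p, this.2, rfl⟩⟩
    · rw [act_mul k _ _ _ (F_HH hq), hqp, act_inv_act k _ _ (F_HH hp)]
    · rw [act_mul k _ _ _ (F_HH hr), hrp, act_inv_act k _ _ (F_HH hp)]

/-! ### Pair lemmas -/

lemma moeb_inv (a b c d x y : ℝ) (h : a * d - b * c = 1) (hy : 0 < y) :
    ((-c) * (moeb a b c d x y).1 + a) ^ 2 + (-c) ^ 2 * (moeb a b c d x y).2 ^ 2 =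
      ((c * x + d) ^ 2 + c ^ 2 * y ^ 2)⁻¹ := by
  have hD := moeb_den a b c d x y h hy
  unfold moeb
  simp only
  set D := (c * x + d) ^ 2 + c ^ 2 * y ^ 2 with hDd
  have e : -c * (((a * x + b) * (c * x + d) + a * c * y ^ 2) / D) + a = (c * x + d) / D := by
    field_simp
    rw [hDd]; linear_combination (c * x + d) * h
  rw [e]
  field_simp
  rw [hDd]

lemma HNorm_act (k : ℕ) (g : SL k) (q : Pt) (hq : q ∈ HH) :
    HNorm ((-g.1 1 0 : R k) : ℝ × ℝ) (g.1 0 0 : ℝ × ℝ) (act k g q) =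
      (HNorm (g.1 1 0 : ℝ × ℝ) (g.1 1 1 : ℝ × ℝ) q)⁻¹ := by
  have e1 := moeb_inv _ _ _ _ (x1 q) (y1 q) (det_fst k g) hq.1
  have e2 := moeb_inv _ _ _ _ (x2 q) (y2 q) (det_snd k g) hq.2
  unfold HNorm
  rw [mul_inv, ← e1, ← e2]
  rfl

lemma spair1 (k : ℕ) (g : SL k) : (-g.1 1 0, g.1 0 0) ∈ Spairs k := by
  show Ideal.span _ = ⊤
  rw [Ideal.eq_top_iff_one, Ideal.mem_span_pair]
  exact ⟨g.1 0 1, g.1 1 1, by simp only; linear_combination det1 k g⟩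

lemma spair2 (k : ℕ) (g : SL k) : (g.1 1 0, g.1 1 1) ∈ Spairs k := by
  show Ideal.span _ = ⊤
  rw [Ideal.eq_top_iff_one, Ideal.mem_span_pair]
  exact ⟨-g.1 0 1, g.1 0 0, by simp only; linear_combination det1 k g⟩

lemma L0 (k : ℕ) (ε : ℝ) (g : SL k) (p : Pt) (h : Tl k ε g p) :
    p ∈ Veq k (-g.1 1 0, g.1 0 0) := by
  obtain ⟨hp, q, hq, rfl⟩ := h
  refine ⟨F_HH hp, ?_⟩
  have h1 := hp.2.2 _ (spair1 k g)
  have h2 := hq.2.2 _ (spair2 k g)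
  simp only at h1 h2 ⊢
  rw [HNorm_act k g q (F_HH hq)] at h1 ⊢
  have := inv_le_one_of_one_le₀ h2
  exact le_antisymm this h1

lemma act_tri (k : ℕ) (g : SL k) (h : g.1 1 0 = 0) (q : Pt) :
    x1 (act k g q) = (g.1 0 0 : ℝ × ℝ).1 ^ 2 * x1 q + (g.1 0 0 : ℝ × ℝ).1 * (g.1 0 1 : ℝ × ℝ).1 ∧
    x2 (act k g q) = (g.1 0 0 : ℝ × ℝ).2 ^ 2 * x2 q + (g.1 0 0 : ℝ × ℝ).2 * (g.1 0 1 : ℝ × ℝ).2 ∧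
    y1 (act k g q) = (g.1 0 0 : ℝ × ℝ).1 ^ 2 * y1 q ∧
    y2 (act k g q) = (g.1 0 0 : ℝ × ℝ).2 ^ 2 * y2 q := by
  have d1 := det_fst k g
  have d2 := det_snd k g
  have aux : ∀ a b d x y : ℝ, a * d = 1 → (moeb a b 0 d x y).1 = a ^ 2 * x + a * b ∧
      (moeb a b 0 d x y).2 = a ^ 2 * y := by
    intro a b d x y had
    have hd : d ≠ 0 := by rintro rfl; simp at had
    have ha : a = 1 / d := by field_simp; linarith
    subst ha
    unfold moeb
    constructor
    · simp only; field_simp; ring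
    · simp only; field_simp; ring
  simp only [act, x1, x2, y1, y2, h] at d1 d2 ⊢
  simp only [ZeroMemClass.coe_zero, Prod.fst_zero, Prod.snd_zero, mul_zero, sub_zero] at d1 d2 ⊢
  exact ⟨(aux _ _ _ _ _ d1).1, (aux _ _ _ _ _ d2).1, (aux _ _ _ _ _ d1).2, (aux _ _ _ _ _ d2).2⟩

lemma tri_unit (k : ℕ) (g : SL k) (h : g.1 1 0 = 0) : g.1 0 0 * g.1 1 1 = 1 := by
  have := det1 k g
  rw [h] at this; simpa using this

lemma rr_tri (k : ℕ) (g : SL k) (h : g.1 1 0 = 0) (q : Pt) :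
    rr (act k g q) = |(g.1 0 0 : ℝ × ℝ).1| ^ 4 * rr q := by
  obtain ⟨_, _, e1, e2⟩ := act_tri k g h q
  have hu := unit_norm k _ _ (tri_unit k g h)
  unfold rr
  rw [e1, e2, ← sq_abs (g.1 0 0 : ℝ × ℝ).1, ← sq_abs (g.1 0 0 : ℝ × ℝ).2]
  generalize |(g.1 0 0 : ℝ × ℝ).1| = A at *
  generalize |(g.1 0 0 : ℝ × ℝ).2| = B at *
  have hA : A ≠ 0 := by rintro rfl; simp at hu
  have hB : B = 1 / A := by field_simp; linarith
  subst hB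
  field_simp

lemma L3p (k : ℕ) (e : (R k)ˣ) (he : IsFundUnit k e) (g : SL k) (h : g.1 1 0 = 0)
    (h1 : 1 < |(g.1 0 0 : ℝ × ℝ).1|) (p : Pt) (hp : Tl k (eps k e) g p) :
    rr p = eps k e ^ 2 ∧ |(g.1 0 0 : ℝ × ℝ).1| = eps k e := by
  obtain ⟨hp, q, hq, rfl⟩ := hp
  have hl := fund_le k e he _ _ (tri_unit k g h) h1
  have he1 : 1 < eps k e := he.1
  obtain ⟨_, _, _, hr⟩ := hp.1.2
  obtain ⟨_, _, hr', _⟩ := hq.1.2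
  rw [rr_tri k g h] at hr ⊢
  set A := |(g.1 0 0 : ℝ × ℝ).1|
  set ε := eps k e
  have hε : 0 < ε := by linarith
  have h4 : A ^ 4 * (ε ^ 2)⁻¹ ≤ A ^ 4 * rr q := by gcongr
  have h5 : ε ^ 4 * (ε ^ 2)⁻¹ ≤ A ^ 4 * (ε ^ 2)⁻¹ := by gcongr
  have h6 : ε ^ 4 * (ε ^ 2)⁻¹ = ε ^ 2 := by field_simp
  refine ⟨by linarith, le_antisymm ?_ hl⟩
  have : A ^ 4 * (ε ^ 2)⁻¹ ≤ ε ^ 4 * (ε ^ 2)⁻¹ := by linarith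
  have := le_of_mul_le_mul_right this (by positivity)
  exact le_of_pow_le_pow_left₀ (by norm_num) hε.le this

lemma L3m (k : ℕ) (e : (R k)ˣ) (he : IsFundUnit k e) (g : SL k) (h : g.1 1 0 = 0)
    (h1 : |(g.1 0 0 : ℝ × ℝ).1| < 1) (p : Pt) (hp : Tl k (eps k e) g p) :
    rr p = (eps k e ^ 2)⁻¹ ∧ |(g.1 0 0 : ℝ × ℝ).1| = (eps k e)⁻¹ := by
  obtain ⟨hp, q, hq, rfl⟩ := hp
  have hu := tri_unit k g h
  have hu' : g.1 1 1 * g.1 0 0 = 1 := by rw [mul_comm]; exact hu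
  have hm : |(g.1 0 0 : ℝ × ℝ).1| * |(g.1 1 1 : ℝ × ℝ).1| = 1 := by
    have := det_fst k g
    rw [h] at this
    rw [← abs_mul]
    simp at this; simp [this]
  have hl := fund_le k e he _ _ hu'
  have he1 : 1 < eps k e := he.1
  obtain ⟨_, _, hr, _⟩ := hp.1.2
  obtain ⟨_, _, _, hr'⟩ := hq.1.2
  rw [rr_tri k g h] at hr ⊢
  have hA0 := abs_nonneg (g.1 0 0 : ℝ × ℝ).1
  set A := |(g.1 0 0 : ℝ × ℝ).1|
  set B := |(g.1 1 1 : ℝ × ℝ).1|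
  set ε := eps k e
  have hε : 0 < ε := by linarith
  have hA : A ≠ 0 := by intro h0; rw [h0] at hm; simp at hm
  have hA' : 0 < A := lt_of_le_of_ne hA0 hA.symm
  have hB : B = A⁻¹ := by field_simp; linarith
  have hlB : ε ≤ A⁻¹ := by
    rw [← hB]; apply hl; rw [hB]; exact (one_lt_inv₀ hA').mpr h1
  have hlA : A ≤ ε⁻¹ := (le_inv_comm₀ hε hA').mp hlB
  have h4 : A ^ 4 * rr q ≤ A ^ 4 * ε ^ 2 := by gcongr
  have h5 : A ^ 4 * ε ^ 2 ≤ ε⁻¹ ^ 4 * ε ^ 2 := by gcongr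
  have h6 : ε⁻¹ ^ 4 * ε ^ 2 = (ε ^ 2)⁻¹ := by field_simp
  refine ⟨by linarith, le_antisymm hlA ?_⟩
  have : ε⁻¹ ^ 4 * ε ^ 2 ≤ A ^ 4 * ε ^ 2 := by linarith
  have := le_of_mul_le_mul_right this (by positivity)
  exact le_of_pow_le_pow_left₀ (by norm_num) hA0 this

lemma abs_one (k : ℕ) (hk : Squarefree k) (hk1 : 1 < k) (a : R k)
    (h : |(a : ℝ × ℝ).1| = 1) : a = 1 ∨ a = -1 := by
  rcases (abs_eq (by norm_num)).mp h with h | h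
  · left
    have := R_inj k hk hk1 (a - 1) (Or.inl (by simp [h]))
    exact sub_eq_zero.mp this
  · right
    have := R_inj k hk hk1 (a + 1) (Or.inl (by simp [h]))
    exact eq_neg_of_add_eq_zero_left this

lemma LT (k : ℕ) (hk : Squarefree k) (hk1 : 1 < k) (g : SL k) (h : g.1 1 0 = 0)
    (h1 : |(g.1 0 0 : ℝ × ℝ).1| = 1) : ∃ m n : ℤ,
    (g.1 0 0 : ℝ × ℝ).1 * (g.1 0 1 : ℝ × ℝ).1 = m + n * omg k ∧
    (∀ q, s1 k (act k g q) = s1 k q + m ∧ s2 k (act k g q) = s2 k q + n) := by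
  obtain ⟨m, n, e1, e2⟩ := R_rep k (g.1 0 0 * g.1 0 1)
  simp only [Subring.coe_mul, Prod.fst_mul, Prod.snd_mul] at e1 e2
  refine ⟨m, n, e1, fun q => ?_⟩
  obtain ⟨t1, t2, _, _⟩ := act_tri k g h q
  rw [e1] at t1
  rw [e2] at t2
  have sq1 : (g.1 0 0 : ℝ × ℝ).1 ^ 2 = 1 := by
    rcases abs_one k hk hk1 _ h1 with h | h <;> simp [h]
  have sq2 : (g.1 0 0 : ℝ × ℝ).2 ^ 2 = 1 := by
    rcases abs_one k hk hk1 _ h1 with h | h <;> simp [h]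
  rw [sq1] at t1
  rw [sq2] at t2
  have hw := (omg_sub k hk1).ne'
  have hw' : omg' k - omg k ≠ 0 := by intro h; apply hw; linarith
  unfold s1 s2
  rw [t1, t2]
  constructor
  · field_simp; ring
  · field_simp; ring

/-! ### Distinctness of varieties -/

/-- point with given coordinates -/
def mk (k : ℕ) (s t u v : ℝ) : Pt := (s + t * omg k, s + t * omg' k, u, v)

lemma mk_spec (k : ℕ) (hk1 : 1 < k) (s t u v : ℝ) : s1 k (mk k s t u v) = s ∧
    s2 k (mk k s t u v) = t ∧ rr (mk k s t u v) = u / v ∧ hh (mk k s t u v) = u * v := by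
  have hw := (omg_sub k hk1).ne'
  have hw' : omg' k - omg k ≠ 0 := by intro h; apply hw; linarith
  refine ⟨?_, ?_, rfl, rfl⟩
  · simp only [s1, mk, x1, x2]; field_simp; ring
  · simp only [s2, mk, x1, x2]; field_simp; ring

lemma mk_HH (k : ℕ) (s t u v : ℝ) (hu : 0 < u) (hv : 0 < v) : mk k s t u v ∈ HH := ⟨hu, hv⟩

lemma inf_unbdd (k : ℕ) (hk1 : 1 < k) (ε : ℝ) (hε : 0 < ε) (V : Set Pt) (hV : V ∈ VfamInf k ε)
    (T : ℝ) (hT : 0 < T) : ∃ p ∈ V, hh p = T := by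
  have hs : 0 < Real.sqrt T := Real.sqrt_pos.mpr hT
  have hst : Real.sqrt T * Real.sqrt T = T := Real.mul_self_sqrt hT.le
  have A : ∀ s t u, 0 < u → ∃ p ∈ HH, s1 k p = s ∧ s2 k p = t ∧ rr p = u ^ 2 ∧ hh p = T := by
    intro s t u hu
    obtain ⟨a1, a2, a3, a4⟩ := mk_spec k hk1 s t (u * Real.sqrt T) (Real.sqrt T / u)
    refine ⟨mk k s t (u * Real.sqrt T) (Real.sqrt T / u), mk_HH _ _ _ _ _ (by positivity)
      (by positivity), a1, a2, ?_, ?_⟩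
    · rw [a3]; field_simp
    · rw [a4]; field_simp; linarith
  simp only [VfamInf, Set.mem_insert_iff, Set.mem_singleton_iff] at hV
  rcases hV with rfl | rfl | rfl | rfl | rfl | rfl
  · obtain ⟨p, h0, h1, h2, h3, h4⟩ := A (1/2) 0 1 one_pos
    exact ⟨p, ⟨h0, h1⟩, h4⟩
  · obtain ⟨p, h0, h1, h2, h3, h4⟩ := A (-(1/2)) 0 1 one_pos
    exact ⟨p, ⟨h0, h1⟩, h4⟩
  · obtain ⟨p, h0, h1, h2, h3, h4⟩ := A 0 (1/2) 1 one_pos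
    exact ⟨p, ⟨h0, h2⟩, h4⟩
  · obtain ⟨p, h0, h1, h2, h3, h4⟩ := A 0 (-(1/2)) 1 one_pos
    exact ⟨p, ⟨h0, h2⟩, h4⟩
  · obtain ⟨p, h0, h1, h2, h3, h4⟩ := A 0 0 ε hε
    exact ⟨p, ⟨h0, h3⟩, h4⟩
  · obtain ⟨p, h0, h1, h2, h3, h4⟩ := A 0 0 ε⁻¹ (by positivity)
    exact ⟨p, ⟨h0, by rw [h3, inv_pow]⟩, h4⟩

lemma inf_ne_V (k : ℕ) (hk : Squarefree k) (hk1 : 1 < k) (ε : ℝ) (hε : 0 < ε) (V : Set Pt)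
    (hV : V ∈ VfamInf k ε) (cd : R k × R k) (hc : cd.1 ≠ 0) : V ≠ Veq k cd := by
  rintro rfl
  have c1 : (cd.1 : ℝ × ℝ).1 ≠ 0 := fun h => hc (R_inj k hk hk1 _ (Or.inl h))
  have c2 : (cd.1 : ℝ × ℝ).2 ≠ 0 := fun h => hc (R_inj k hk hk1 _ (Or.inr h))
  obtain ⟨p, ⟨hp, hN⟩, hT⟩ := inf_unbdd k hk1 ε hε _ hV
    (2 / |(cd.1 : ℝ × ℝ).1 * (cd.1 : ℝ × ℝ).2|) (by positivity)
  unfold HNorm at hN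
  unfold hh at hT
  have hc0 : 0 < |(cd.1 : ℝ × ℝ).1 * (cd.1 : ℝ × ℝ).2| := by positivity
  have h2 : |(cd.1 : ℝ × ℝ).1 * (cd.1 : ℝ × ℝ).2| * (y1 p * y2 p) = 2 := by
    rw [hT]; field_simp
  have h4 : ((cd.1 : ℝ × ℝ).1 * (cd.1 : ℝ × ℝ).2) ^ 2 * (y1 p * y2 p) ^ 2 = 4 := by
    rw [← sq_abs, ← mul_pow, h2]; norm_num
  have : ((cd.1 : ℝ × ℝ).1 ^ 2 * y1 p ^ 2) * ((cd.1 : ℝ × ℝ).2 ^ 2 * y2 p ^ 2) ≤ 1 := by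
    rw [← hN]
    gcongr <;> nlinarith [sq_nonneg ((cd.1 : ℝ × ℝ).1 * x1 p + (cd.2 : ℝ × ℝ).1),
      sq_nonneg ((cd.1 : ℝ × ℝ).2 * x2 p + (cd.2 : ℝ × ℝ).2)]
  nlinarith

lemma V_inj (k : ℕ) (hk : Squarefree k) (hk1 : 1 < k) (cd cd' : R k × R k) (hc : cd.1 ≠ 0)
    (hc' : cd'.1 ≠ 0) (h : Veq k cd = Veq k cd') : cd.1 * cd'.2 - cd.2 * cd'.1 = 0 := by
  by_contra hD
  obtain ⟨c, d⟩ := cd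
  obtain ⟨c', d'⟩ := cd'
  simp only at hc hc' hD
  have c1 : (c : ℝ × ℝ).1 ≠ 0 := fun h => hc (R_inj k hk hk1 _ (Or.inl h))
  have c2 : (c : ℝ × ℝ).2 ≠ 0 := fun h => hc (R_inj k hk hk1 _ (Or.inr h))
  have c1' : (c' : ℝ × ℝ).1 ≠ 0 := fun h => hc' (R_inj k hk hk1 _ (Or.inl h))
  have c2' : (c' : ℝ × ℝ).2 ≠ 0 := fun h => hc' (R_inj k hk hk1 _ (Or.inr h))
  have hD2 : (c : ℝ × ℝ).2 * (d' : ℝ × ℝ).2 - (d : ℝ × ℝ).2 * (c' : ℝ × ℝ).2 ≠ 0 := by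
    intro h0
    exact hD (R_inj k hk hk1 _ (Or.inr (by simpa using h0)))
  obtain ⟨⟨a1, a2⟩, ha⟩ := c
  obtain ⟨⟨b1, b2⟩, hb⟩ := d
  obtain ⟨⟨a1', a2'⟩, ha'⟩ := c'
  obtain ⟨⟨b1', b2'⟩, hb'⟩ := d'
  simp only at c1 c2 c1' c2' hD2
  set E := (a2 * b2' - b2 * a2') / a2 with hE
  have hE0 : E ≠ 0 := div_ne_zero hD2 c2
  set y := 1 / |a1' * E| with hy
  have hy0 : 0 < y := by positivity
  set z := 1 / (|a1 * a2| * y) with hz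
  have hz0 : 0 < z := by positivity
  have hyz : (a1 * a2) ^ 2 * (y * z) ^ 2 = 1 := by
    rw [← sq_abs (a1 * a2), ← mul_pow, hz]
    have : |a1 * a2| ≠ 0 := by positivity
    field_simp
  have hyE : (a1' * E) ^ 2 * y ^ 2 = 1 := by
    rw [← sq_abs (a1' * E), ← mul_pow, hy]
    have : |a1' * E| ≠ 0 := by positivity
    field_simp
  have hp : ((-b1 / a1, -b2 / a2, y, z) : Pt) ∈ Veq k (⟨(a1, a2), ha⟩, ⟨(b1, b2), hb⟩) := by
    refine ⟨⟨hy0, hz0⟩, ?_⟩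
    simp only [HNorm, x1, x2, y1, y2]
    rw [← hyz]
    field_simp
    ring
  rw [h] at hp
  have hn := hp.2
  simp only [HNorm, x1, x2, y1, y2] at hn
  have e2 : a2' * (-b2 / a2) + b2' = E := by rw [hE]; field_simp; ring
  rw [e2] at hn
  have p1 : 0 < a1' ^ 2 * y ^ 2 := by positivity
  have p2 : 0 < a2' ^ 2 * z ^ 2 := by positivity
  have p3 : 0 ≤ (a1' * (-b1 / a1) + b1') ^ 2 := sq_nonneg _
  have p4 : 0 < E ^ 2 := by positivity
  nlinarith [mul_pos p1 p2, mul_nonneg p3 p4.le, mul_nonneg p3 p2.le]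

/-! ### Combination -/

def sg (m : ℤ) : ℝ := if 0 < m then 1 / 2 else -(1 / 2)

def W1 (k : ℕ) (m : ℤ) : Set Pt := {p ∈ HH | s1 k p = sg m}

def W2 (k : ℕ) (m : ℤ) : Set Pt := {p ∈ HH | s2 k p = sg m}

def W3 (ε A : ℝ) : Set Pt := {p ∈ HH | rr p = if 1 < A then ε ^ 2 else (ε ^ 2)⁻¹}

lemma W1_mem (k : ℕ) (ε : ℝ) (m : ℤ) : W1 k m ∈ VfamInf k ε := by
  unfold W1 sg VfamInf; split_ifs <;> simp

lemma W2_mem (k : ℕ) (ε : ℝ) (m : ℤ) : W2 k m ∈ VfamInf k ε := by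
  unfold W2 sg VfamInf; split_ifs <;> simp

lemma W3_mem (k : ℕ) (ε A : ℝ) : W3 ε A ∈ VfamInf k ε := by
  unfold W3 VfamInf; split_ifs <;> simp

lemma sg_ne (m : ℤ) : sg m ≠ 0 := by unfold sg; split_ifs <;> norm_num

lemma W12 (k : ℕ) (hk1 : 1 < k) (m n : ℤ) : W1 k m ≠ W2 k n := by
  intro h
  obtain ⟨a1, a2, -, -⟩ := mk_spec k hk1 (sg m) 0 1 1
  have : mk k (sg m) 0 1 1 ∈ W1 k m := ⟨mk_HH _ _ _ _ _ one_pos one_pos, a1⟩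
  rw [h] at this
  exact sg_ne n (this.2.symm.trans a2)

lemma W11 (k : ℕ) (hk1 : 1 < k) (m n : ℤ) (h : sg m ≠ sg n) : W1 k m ≠ W1 k n := by
  intro h'
  obtain ⟨a1, a2, -, -⟩ := mk_spec k hk1 (sg m) 0 1 1
  have : mk k (sg m) 0 1 1 ∈ W1 k m := ⟨mk_HH _ _ _ _ _ one_pos one_pos, a1⟩
  rw [h'] at this
  exact h (a1.symm.trans this.2)

lemma W22 (k : ℕ) (hk1 : 1 < k) (m n : ℤ) (h : sg m ≠ sg n) : W2 k m ≠ W2 k n := by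
  intro h'
  obtain ⟨a1, a2, -, -⟩ := mk_spec k hk1 0 (sg m) 1 1
  have : mk k 0 (sg m) 1 1 ∈ W2 k m := ⟨mk_HH _ _ _ _ _ one_pos one_pos, a2⟩
  rw [h'] at this
  exact h (a2.symm.trans this.2)

lemma W3_pt (k : ℕ) (hk1 : 1 < k) (ε A : ℝ) (hε : 0 < ε) :
    ∃ p ∈ W3 ε A, s1 k p = 0 ∧ s2 k p = 0 := by
  have hu : 0 < (if 1 < A then ε ^ 2 else (ε ^ 2)⁻¹) := by split_ifs <;> positivity
  obtain ⟨a1, a2, a3, -⟩ := mk_spec k hk1 0 0 (if 1 < A then ε ^ 2 else (ε ^ 2)⁻¹) 1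
  exact ⟨_, ⟨mk_HH k 0 0 _ 1 hu one_pos, by rw [a3, div_one]⟩, a1, a2⟩

lemma W13 (k : ℕ) (hk1 : 1 < k) (ε A : ℝ) (hε : 0 < ε) (m : ℤ) : W1 k m ≠ W3 ε A := by
  intro h
  obtain ⟨p, hp, h1, h2⟩ := W3_pt k hk1 ε A hε
  rw [← h] at hp
  exact sg_ne m (hp.2.symm.trans h1)

lemma W23 (k : ℕ) (hk1 : 1 < k) (ε A : ℝ) (hε : 0 < ε) (m : ℤ) : W2 k m ≠ W3 ε A := by
  intro h
  obtain ⟨p, hp, h1, h2⟩ := W3_pt k hk1 ε A hε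
  rw [← h] at hp
  exact sg_ne m (hp.2.symm.trans h2)

lemma W33 (k : ℕ) (hk1 : 1 < k) (ε A B : ℝ) (hε : 1 < ε) (hA : 1 < A) (hB : ¬ 1 < B) :
    W3 ε A ≠ W3 ε B := by
  intro h
  obtain ⟨p, hp, -, -⟩ := W3_pt k hk1 ε A (by linarith)
  have h1 := hp.2
  rw [h] at hp
  have h2 := hp.2
  rw [h1, if_pos hA, if_neg hB] at h2
  have : 1 < ε ^ 2 := one_lt_pow₀ hε (by norm_num)
  have h3 := inv_lt_one_of_one_lt₀ this
  linarith

lemma shift (s t : ℝ) (m : ℤ) (hm : m ≠ 0) (hs : |s| ≤ 1 / 2) (ht : |t| ≤ 1 / 2)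
    (h : s = t + m) : s = sg m ∧ (m = 1 ∨ m = -1) := by
  rw [abs_le] at hs ht
  have b1 : m ≤ 1 := by
    have : (m : ℝ) ≤ (1 : ℤ) := by push_cast; linarith
    exact_mod_cast this
  have b2 : -1 ≤ m := by
    have : ((-1 : ℤ) : ℝ) ≤ m := by push_cast; linarith
    exact_mod_cast this
  have : m = 1 ∨ m = -1 := by omega
  refine ⟨?_, this⟩
  rcases this with rfl | rfl
  · simp [sg] at h ⊢; linarith
  · simp [sg] at h ⊢; linarith

lemma PT (k : ℕ) (hk : Squarefree k) (hk1 : 1 < k) (ε : ℝ) (g : SL k)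
    (h : g.1 1 0 = 0) (h1 : |(g.1 0 0 : ℝ × ℝ).1| = 1) : ∃ m n : ℤ,
    (g.1 0 0 : ℝ × ℝ).1 * (g.1 0 1 : ℝ × ℝ).1 = m + n * omg k ∧
    (m ≠ 0 → ∀ p, Tl k ε g p → p ∈ W1 k m ∧ (m = 1 ∨ m = -1)) ∧
    (n ≠ 0 → ∀ p, Tl k ε g p → p ∈ W2 k n ∧ (n = 1 ∨ n = -1)) := by
  obtain ⟨m, n, h0, h2⟩ := LT k hk hk1 g h h1
  refine ⟨m, n, h0, ?_, ?_⟩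
  · rintro hm p ⟨hp, q, hq, rfl⟩
    have := shift _ _ m hm hp.1.2.1 hq.1.2.1 (h2 q).1
    exact ⟨⟨F_HH hp, this.1⟩, this.2⟩
  · rintro hm p ⟨hp, q, hq, rfl⟩
    have := shift _ _ n hm hp.1.2.2.1 hq.1.2.2.1 (h2 q).2
    exact ⟨⟨F_HH hp, this.1⟩, this.2⟩

lemma P3 (k : ℕ) (e : (R k)ˣ) (he : IsFundUnit k e) (g : SL k) (h : g.1 1 0 = 0)
    (h1 : |(g.1 0 0 : ℝ × ℝ).1| ≠ 1) (p : Pt) (hp : Tl k (eps k e) g p) :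
    p ∈ W3 (eps k e) |(g.1 0 0 : ℝ × ℝ).1| ∧
    |(g.1 0 0 : ℝ × ℝ).1| = if 1 < |(g.1 0 0 : ℝ × ℝ).1| then eps k e else (eps k e)⁻¹ := by
  rcases lt_or_gt_of_ne h1 with h1 | h1
  · obtain ⟨a, b⟩ := L3m k e he g h h1 p hp
    refine ⟨⟨F_HH hp.1, ?_⟩, ?_⟩
    · rw [if_neg h1.not_gt]; exact a
    · rw [if_neg h1.not_gt]; exact b
  · obtain ⟨a, b⟩ := L3p k e he g h h1 p hp
    refine ⟨⟨F_HH hp.1, ?_⟩, ?_⟩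
    · rw [if_pos h1]; exact a
    · rw [if_pos h1]; exact b

/-- `g` acts trivially -/
def Triv (k : ℕ) (g : SL k) : Prop := g.1 1 0 = 0 ∧ |(g.1 0 0 : ℝ × ℝ).1| = 1 ∧ g.1 0 1 = 0

lemma PT' (k : ℕ) (hk : Squarefree k) (hk1 : 1 < k) (ε : ℝ) (g : SL k) (hT : ¬ Triv k g)
    (h : g.1 1 0 = 0) (h1 : |(g.1 0 0 : ℝ × ℝ).1| = 1) :
    ∃ V, (∃ m, V = W1 k m ∨ V = W2 k m) ∧ ∀ p, Tl k ε g p → p ∈ V := by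
  obtain ⟨m, n, h0, hm, hn⟩ := PT k hk hk1 ε g h h1
  by_cases m0 : m = 0
  · by_cases n0 : n = 0
    · exfalso
      subst m0 n0
      have : (g.1 0 1 : ℝ × ℝ).1 = 0 := by
        simp at h0
        rcases h0 with h0 | h0
        · rw [h0] at h1; simp at h1
        · exact h0
      exact hT ⟨h, h1, R_inj k hk hk1 _ (Or.inl this)⟩
    · exact ⟨_, ⟨n, Or.inr rfl⟩, fun p hp => (hn n0 p hp).1⟩
  · exact ⟨_, ⟨m, Or.inl rfl⟩, fun p hp => (hm m0 p hp).1⟩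

lemma Pinf (k : ℕ) (hk : Squarefree k) (hk1 : 1 < k) (e : (R k)ˣ) (he : IsFundUnit k e) (g : SL k)
    (hT : ¬ Triv k g) (h : g.1 1 0 = 0) :
    ∃ V ∈ VfamInf k (eps k e), ∀ p, Tl k (eps k e) g p → p ∈ V := by
  by_cases h1 : |(g.1 0 0 : ℝ × ℝ).1| = 1
  · obtain ⟨V, ⟨m, rfl | rfl⟩, hV⟩ := PT' k hk hk1 (eps k e) g hT h h1
    · exact ⟨_, W1_mem k _ m, hV⟩
    · exact ⟨_, W2_mem k _ m, hV⟩
  · exact ⟨_, W3_mem k _ _, fun p hp => (P3 k e he g h h1 p hp).1⟩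

lemma triv_eq (k : ℕ) (hk : Squarefree k) (hk1 : 1 < k) (ε : ℝ) (g h : SL k)
    (hT : Triv k (g⁻¹ * h)) : act k g '' F k ε = act k h '' F k ε := by
  obtain ⟨t1, t2, t3⟩ := hT
  have : ∀ p ∈ F k ε, act k h p = act k g p := by
    intro p hp
    have e1 : act k (g⁻¹ * h) p = p := by
      obtain ⟨a1, a2, a3, a4⟩ := act_tri k _ t1 p
      rcases abs_one k hk hk1 _ t2 with h0 | h0 <;> rw [h0, t3] at a1 a2 <;> rw [h0] at a3 a4 <;>
        simp at a1 a2 a3 a4 <;>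
        exact Prod.ext a1 (Prod.ext a2 (Prod.ext a3 a4))
    have : h = g * (g⁻¹ * h) := by group
    rw [this, act_mul k _ _ _ (F_HH hp), e1]
  exact Set.image_congr fun p hp => (this p hp).symm

def E1 (k : ℕ) (g h : SL k) : Prop := (g⁻¹ * h).1 1 0 = 0

def E2 (k : ℕ) (g h : SL k) : Prop := |((g⁻¹ * h).1 0 0 : ℝ × ℝ).1| = 1

lemma inv_mul_ent (k : ℕ) (g h : SL k) :
    (g⁻¹ * h).1 0 0 = g.1 1 1 * h.1 0 0 - g.1 0 1 * h.1 1 0 ∧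
    (g⁻¹ * h).1 0 1 = g.1 1 1 * h.1 0 1 - g.1 0 1 * h.1 1 1 ∧
    (g⁻¹ * h).1 1 0 = g.1 0 0 * h.1 1 0 - g.1 1 0 * h.1 0 0 := by
  obtain ⟨i1, i2, i3, i4⟩ := inv_ent k g
  simp only [mul_ent, i1, i2, i3, i4]
  refine ⟨?_, ?_, ?_⟩ <;> ring

lemma rel (k : ℕ) (g1 g2 g3 : SL k) : g2⁻¹ * g3 = (g1⁻¹ * g2)⁻¹ * (g1⁻¹ * g3) := by group

lemma E1.symm {k : ℕ} {g h : SL k} (H : E1 k g h) : E1 k h g := by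
  unfold E1 at *
  have : h⁻¹ * g = (g⁻¹ * h)⁻¹ := by group
  rw [this, (inv_ent k _).2.2.1, H, neg_zero]

lemma E1.tr {k : ℕ} {g1 g2 g3 : SL k} (H : E1 k g1 g2) (H' : E1 k g1 g3) : E1 k g2 g3 := by
  unfold E1 at *
  rw [rel k g1, (inv_mul_ent k _ _).2.2, H, H']; ring

lemma E2_mul {k : ℕ} {g1 g2 g3 : SL k} (H : E1 k g1 g2) (H' : E1 k g1 g3) :
    |((g1⁻¹ * g2).1 0 0 : ℝ × ℝ).1| * |((g2⁻¹ * g3).1 0 0 : ℝ × ℝ).1| =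
      |((g1⁻¹ * g3).1 0 0 : ℝ × ℝ).1| := by
  have hu := tri_unit k _ H
  rw [rel k g1 g2 g3, ← abs_mul, ← Prod.fst_mul, ← Subring.coe_mul]
  congr 3
  rw [(inv_mul_ent k (g1⁻¹ * g2) (g1⁻¹ * g3)).1, show (g1⁻¹ * g3).1 1 0 = 0 from H']
  linear_combination (g1⁻¹ * g3).1 0 0 * hu

lemma E2.symm {k : ℕ} {g h : SL k} (H1 : E1 k g h) (H : E2 k g h) : E2 k h g := by
  have h0 : E1 k g g := by simp [E1]
  have := E2_mul H1 h0
  unfold E2 at *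
  rw [H] at this
  simpa using this

lemma fp (k : ℕ) (e : (R k)ˣ) (he : IsFundUnit k e) : 1 < eps k e := he.1

section
variable (k : ℕ) (hk : Squarefree k) (hk1 : 1 < k) (e : (R k)ˣ) (he : IsFundUnit k e)
  (g1 g2 g3 : SL k)

lemma caseEmpty (hk1 : 1 < k) (ε : ℝ)
    (h : ∀ p, Tl k ε (g1⁻¹ * g2) p → Tl k ε (g1⁻¹ * g3) p → False) : Concl k ε g1 g2 g3 :=
  core k ε g1 g2 g3 _ _ (Or.inr (W1_mem k ε 0)) (Or.inr (W2_mem k ε 0)) (W12 k hk1 0 0)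
    fun p h1 h2 => (h p h1 h2).elim

include hk hk1 in
lemma caseA (ε : ℝ) (h12 : ¬ E1 k g1 g2) (h13 : ¬ E1 k g1 g3) (h23 : ¬ E1 k g2 g3) :
    Concl k ε g1 g2 g3 := by
  have n1 : -(g1⁻¹ * g2).1 1 0 ≠ 0 := neg_ne_zero.mpr h12
  have n2 : -(g1⁻¹ * g3).1 1 0 ≠ 0 := neg_ne_zero.mpr h13
  refine core k ε g1 g2 g3 _ _ (Or.inl ⟨_, spair1 k _, n1, rfl⟩)
    (Or.inl ⟨_, spair1 k _, n2, rfl⟩) ?_ fun p h1 h2 => ⟨L0 k ε _ p h1, L0 k ε _ p h2⟩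
  intro h
  have := V_inj k hk hk1 _ _ n1 n2 h
  apply h23
  unfold E1
  rw [rel k g1, (inv_mul_ent k _ _).2.2]
  simp only at this
  linear_combination this

include hk hk1 he in
lemma caseB (hT : ¬ Triv k (g1⁻¹ * g2)) (h12 : E1 k g1 g2) (h13 : ¬ E1 k g1 g3) :
    Concl k (eps k e) g1 g2 g3 := by
  have n2 : -(g1⁻¹ * g3).1 1 0 ≠ 0 := neg_ne_zero.mpr h13
  obtain ⟨V, hV, hp⟩ := Pinf k hk hk1 e he _ hT h12
  have := fp k e he
  exact core k _ g1 g2 g3 _ _ (Or.inr hV) (Or.inl ⟨_, spair1 k _, n2, rfl⟩)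
    (inf_ne_V k hk hk1 _ (by linarith) V hV _ n2) fun p h1 h2 => ⟨hp p h1, L0 k _ _ p h2⟩

include hk1 he in
lemma caseC (h12 : E1 k g1 g2) (h13 : E1 k g1 g3) (k12 : ¬ E2 k g1 g2) (k13 : ¬ E2 k g1 g3)
    (k23 : ¬ E2 k g2 g3) : Concl k (eps k e) g1 g2 g3 := by
  have hε := fp k e he
  by_cases hem : ∀ p, Tl k (eps k e) (g1⁻¹ * g2) p → Tl k (eps k e) (g1⁻¹ * g3) p → False
  · exact caseEmpty k g1 g2 g3 hk1 _ hem
  push Not at hem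
  obtain ⟨p, hp1, hp2, -⟩ := hem
  have q1 := P3 k e he _ h12 k12
  have q2 := P3 k e he _ h13 k13
  refine core k _ g1 g2 g3 _ _ (Or.inr (W3_mem k _ _)) (Or.inr (W3_mem k _ _)) ?_
    fun p h1 h2 => ⟨(q1 p h1).1, (q2 p h2).1⟩
  have r1 := (q1 p hp1).2
  have r2 := (q2 p hp2).2
  have hm := E2_mul h12 h13
  have hne : |((g1⁻¹ * g2).1 0 0 : ℝ × ℝ).1| ≠ |((g1⁻¹ * g3).1 0 0 : ℝ × ℝ).1| := by
    intro h
    rw [← h] at hm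
    have h0 : |((g1⁻¹ * g2).1 0 0 : ℝ × ℝ).1| ≠ 0 := by
      rw [r1]
      have : 0 < eps k e := by linarith
      split_ifs <;> positivity
    exact k23 (mul_left_cancel₀ h0 (by rw [hm, mul_one]))
  generalize |((g1⁻¹ * g2).1 0 0 : ℝ × ℝ).1| = A at *
  generalize |((g1⁻¹ * g3).1 0 0 : ℝ × ℝ).1| = B at *
  by_cases hA : 1 < A <;> by_cases hB : 1 < B
  · rw [if_pos hA] at r1; rw [if_pos hB] at r2; exact absurd (r1.trans r2.symm) hne
  · exact W33 k hk1 _ _ _ hε hA hB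
  · exact (W33 k hk1 _ _ _ hε hB hA).symm
  · rw [if_neg hA] at r1; rw [if_neg hB] at r2; exact absurd (r1.trans r2.symm) hne

include hk hk1 he in
lemma caseD (hT : ¬ Triv k (g1⁻¹ * g2)) (h12 : E1 k g1 g2) (h13 : E1 k g1 g3) (k12 : E2 k g1 g2)
    (k13 : ¬ E2 k g1 g3) : Concl k (eps k e) g1 g2 g3 := by
  have hε := fp k e he
  have q2 := P3 k e he _ h13 k13
  obtain ⟨V, ⟨m, rfl | rfl⟩, hV⟩ := PT' k hk hk1 (eps k e) _ hT h12 k12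
  · exact core k _ g1 g2 g3 _ _ (Or.inr (W1_mem k _ _)) (Or.inr (W3_mem k _ _))
      (W13 k hk1 _ _ (by linarith) m) fun p h1 h2 => ⟨hV p h1, (q2 p h2).1⟩
  · exact core k _ g1 g2 g3 _ _ (Or.inr (W2_mem k _ _)) (Or.inr (W3_mem k _ _))
      (W23 k hk1 _ _ (by linarith) m) fun p h1 h2 => ⟨hV p h1, (q2 p h2).1⟩

lemma sg_ne' {m n : ℤ} (hm : m = 1 ∨ m = -1) (hn : n = 1 ∨ n = -1) (h : m ≠ n) :
    sg m ≠ sg n := by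
  rcases hm with rfl | rfl <;> rcases hn with rfl | rfl <;> simp [sg] at h ⊢ <;> norm_num

include hk hk1 in
lemma caseE (ε : ℝ) (T12 : ¬ Triv k (g1⁻¹ * g2)) (T13 : ¬ Triv k (g1⁻¹ * g3))
    (T23 : ¬ Triv k (g2⁻¹ * g3))
    (h12 : E1 k g1 g2) (h13 : E1 k g1 g3) (k12 : E2 k g1 g2)
    (k13 : E2 k g1 g3) : Concl k ε g1 g2 g3 := by
  by_cases hem : ∀ p, Tl k ε (g1⁻¹ * g2) p → Tl k ε (g1⁻¹ * g3) p → False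
  · exact caseEmpty k g1 g2 g3 hk1 _ hem
  push Not at hem
  obtain ⟨p, hp1, hp2, -⟩ := hem
  have h23 := h12.tr h13
  have k23 : E2 k g2 g3 := by
    have := E2_mul h12 h13
    unfold E2 at *
    rw [k12, k13] at this; linarith
  obtain ⟨m, n, e0, hm, hn⟩ := PT k hk hk1 ε _ h12 k12
  obtain ⟨m', n', e0', hm', hn'⟩ := PT k hk hk1 ε _ h13 k13
  have key : ∀ g : SL k, g.1 1 0 = 0 → |(g.1 0 0 : ℝ × ℝ).1| = 1 → ¬ Triv k g → ∀ m n : ℤ,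
      (g.1 0 0 : ℝ × ℝ).1 * (g.1 0 1 : ℝ × ℝ).1 = m + n * omg k → ¬ (m = 0 ∧ n = 0) := by
    rintro g a1 a2 a3 m n a4 ⟨rfl, rfl⟩
    have : (g.1 0 1 : ℝ × ℝ).1 = 0 := by
      simp at a4
      rcases a4 with a4 | a4
      · rw [a4] at a2; simp at a2
      · exact a4
    exact a3 ⟨a1, a2, R_inj k hk hk1 _ (Or.inl this)⟩
  have z1 := key _ h12 k12 T12 m n e0
  have z2 := key _ h13 k13 T13 m' n' e0'
  have z3 : ¬ (m = m' ∧ n = n') := by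
    rintro ⟨rfl, rfl⟩
    apply T23
    refine ⟨h23, k23, ?_⟩
    rw [rel k g1, (inv_mul_ent k _ _).2.1]
    have u1 := tri_unit k _ h12
    have u2 := tri_unit k _ h13
    have hsub := R_inj k hk hk1 ((g1⁻¹ * g2).1 0 0 * (g1⁻¹ * g2).1 0 1 -
      (g1⁻¹ * g3).1 0 0 * (g1⁻¹ * g3).1 0 1)
      (Or.inl (by
        simp only [AddSubgroupClass.coe_sub, Subring.coe_mul, Prod.fst_sub, Prod.fst_mul]
        rw [e0, e0', sub_self]))
    rcases abs_one k hk hk1 _ k12 with w1 | w1 <;> rcases abs_one k hk hk1 _ k13 with w2 | w2 <;>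
      rw [w1] at u1 hsub <;> rw [w2] at u2 hsub
    · linear_combination -hsub + (g1⁻¹ * g3).1 0 1 * u1 - (g1⁻¹ * g2).1 0 1 * u2
    · linear_combination hsub + (g1⁻¹ * g3).1 0 1 * u1 + (g1⁻¹ * g2).1 0 1 * u2
    · linear_combination hsub - (g1⁻¹ * g3).1 0 1 * u1 - (g1⁻¹ * g2).1 0 1 * u2
    · linear_combination hsub * (-1) - (g1⁻¹ * g3).1 0 1 * u1 + (g1⁻¹ * g2).1 0 1 * u2
  have M1 := fun m => Or.inr (a := W1 k m ∈ Vfam k) (W1_mem k ε m)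
  have M2 := fun m => Or.inr (a := W2 k m ∈ Vfam k) (W2_mem k ε m)
  by_cases m0 : m = 0
  · have n0 : n ≠ 0 := fun h => z1 ⟨m0, h⟩
    by_cases m0' : m' = 0
    · have n0' : n' ≠ 0 := fun h => z2 ⟨m0', h⟩
      refine core k _ g1 g2 g3 _ _ (M2 n) (M2 n') (W22 k hk1 _ _ ?_)
        fun p h1 h2 => ⟨(hn n0 p h1).1, (hn' n0' p h2).1⟩
      exact sg_ne' (hn n0 p hp1).2 (hn' n0' p hp2).2 fun h => z3 ⟨m0.trans m0'.symm, h⟩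
    · exact core k _ g1 g2 g3 _ _ (M2 n) (M1 m') (W12 k hk1 _ _).symm
        fun p h1 h2 => ⟨(hn n0 p h1).1, (hm' m0' p h2).1⟩
  · by_cases n0' : n' = 0
    · have m0' : m' ≠ 0 := fun h => z2 ⟨h, n0'⟩
      by_cases n0 : n = 0
      · refine core k _ g1 g2 g3 _ _ (M1 m) (M1 m') (W11 k hk1 _ _ ?_)
          fun p h1 h2 => ⟨(hm m0 p h1).1, (hm' m0' p h2).1⟩
        exact sg_ne' (hm m0 p hp1).2 (hm' m0' p hp2).2 fun h => z3 ⟨h, n0.trans n0'.symm⟩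
      · exact core k _ g1 g2 g3 _ _ (M2 n) (M1 m') (W12 k hk1 _ _).symm
          fun p h1 h2 => ⟨(hn n0 p h1).1, (hm' m0' p h2).1⟩
    · exact core k _ g1 g2 g3 _ _ (M1 m) (M2 n') (W12 k hk1 _ _)
        fun p h1 h2 => ⟨(hm m0 p h1).1, (hn' n0' p h2).1⟩

end

/-- Let `T₁, T₂, T₃` be three pairwise different tiles `Tᵢ = γᵢ(F)`. Then
`T₁ ∩ T₂ ∩ T₃ ⊆ M₁ ∩ M₂` for two distinct elements `M₁, M₂` of `𝓜`. -/
theorem three_tiles_subset_two_varieties (k : ℕ) (hk : Squarefree k) (hk1 : 1 < k)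
    (e : (R k)ˣ) (he : IsFundUnit k e) (g1 g2 g3 : SL k)
    (h12 : act k g1 '' F k (eps k e) ≠ act k g2 '' F k (eps k e))
    (h13 : act k g1 '' F k (eps k e) ≠ act k g3 '' F k (eps k e))
    (h23 : act k g2 '' F k (eps k e) ≠ act k g3 '' F k (eps k e)) :
    ∃ M1 ∈ Mfam k (eps k e), ∃ M2 ∈ Mfam k (eps k e), M1 ≠ M2 ∧
      act k g1 '' F k (eps k e) ∩ act k g2 '' F k (eps k e) ∩
        act k g3 '' F k (eps k e) ⊆ M1 ∩ M2 := by
  have T12 : ¬ Triv k (g1⁻¹ * g2) := fun h => h12 (triv_eq k hk hk1 _ _ _ h)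
  have T13 : ¬ Triv k (g1⁻¹ * g3) := fun h => h13 (triv_eq k hk hk1 _ _ _ h)
  have T23 : ¬ Triv k (g2⁻¹ * g3) := fun h => h23 (triv_eq k hk hk1 _ _ _ h)
  show Concl k (eps k e) g1 g2 g3
  by_cases a12 : E1 k g1 g2
  · by_cases a13 : E1 k g1 g3
    · have a23 := a12.tr a13
      by_cases b12 : E2 k g1 g2
      · by_cases b13 : E2 k g1 g3
        · exact caseE k hk hk1 g1 g2 g3 _ T12 T13 T23 a12 a13 b12 b13
        · exact caseD k hk hk1 e he g1 g2 g3 T12 a12 a13 b12 b13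
      · by_cases b13 : E2 k g1 g3
        · exact (caseD k hk hk1 e he g1 g3 g2 T13 a13 a12 b13 b12).swap
        · by_cases b23 : E2 k g2 g3
          · exact (caseD k hk hk1 e he g2 g3 g1 T23 a23 a12.symm b23
              fun h => b12 (E2.symm a12.symm h)).rot
          · exact caseC k hk1 e he g1 g2 g3 a12 a13 b12 b13 b23
    · exact caseB k hk hk1 e he g1 g2 g3 T12 a12 a13
  · by_cases a13 : E1 k g1 g3
    · exact (caseB k hk hk1 e he g1 g3 g2 T13 a13 a12).swap
    · by_cases a23 : E1 k g2 g3
      · exact (caseB k hk hk1 e he g2 g3 g1 T23 a23 fun h => a12 h.symm).rot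
      · exact caseA k hk hk1 g1 g2 g3 _ a12 a13 a23

end Hilbert
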